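/- Let A = ℂ[x_1, x_2, x_3], f_7 = (x_1·x_3 + x_2)·(x_1^7 − x_2^7), and g_j = ∂f_7/∂x_j for j = 1, 2, 3. Then s^5·p ∈ ker^{(1)}φ for every p ∈ ker φ, but there exists p ∈ ker φ with s^4·p ∉ ker^{(1)}φ. In other words, the divisor D_7 satisfies property (GCL) with minimal exponent N = 5. -/

import Mathlib

open MvPolynomial

set_option synthInstance.maxHeartbeats 1000000
set_option maxHeartbeats 1000000

/-- The `A`-algebra map `φ : A[s, ξ_1, …, ξ_n] → A[t]` with `φ(s) = f·t` and
`φ(ξ_j) = g_j·t`; variable `0` is `s` and variable `j.succ` is `ξ_j`. Its image is the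
Rees algebra of the ideal `(f, g_1, …, g_n)`. -/
noncomputable def reesPhi {A : Type*} [CommRing A] {n : ℕ} (f : A) (g : Fin n → A) :
    MvPolynomial (Fin (n + 1)) A →ₐ[A] Polynomial A :=
  aeval (Fin.cons (Polynomial.C f * Polynomial.X) fun j => Polynomial.C (g j) * Polynomial.X)

/-- `ker^{(1)} φ`: the ideal of `A[s, ξ_1, …, ξ_n]` generated by the homogeneous
elements of degree `1` lying in `ker φ`. -/
noncomputable def kerOne {A : Type*} [CommRing A] {n : ℕ} (f : A) (g : Fin n → A) :
    Ideal (MvPolynomial (Fin (n + 1)) A) :=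
  Ideal.span {p | p ∈ RingHom.ker (reesPhi f g) ∧ p.IsHomogeneous 1}

/-- The member `k = 7` of the family `D_k`: `f_7 = (x_1·x_3 + x_2)·(x_1^7 − x_2^7)` in
`ℂ[x_1, x_2, x_3]`. -/
noncomputable def fD7 : MvPolynomial (Fin 3) ℂ :=
  (X 0 * X 2 + X 1) * (X 0 ^ 7 - X 1 ^ 7)

universe u

/-- The localization of `R ⧸ I` away from `u`, described by its universal properties. -/
lemma exists_ringHom_away_quotient {R : Type u} [CommRing R] (I : Ideal R) (u : R) :
    ∃ (Λ : Type u) (_ : CommRing Λ) (q : R →+* Λ) (i : Λ), q u * i = 1 ∧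
      (∀ t ∈ I, q t = 0) ∧ ∀ p, q p = 0 → ∃ n : ℕ, u ^ n * p ∈ I := by
  set Λ := Localization.Away (Ideal.Quotient.mk I u)
  refine ⟨Λ, inferInstance, (algebraMap (R ⧸ I) Λ).comp (Ideal.Quotient.mk I),
    IsLocalization.Away.invSelf (Ideal.Quotient.mk I u),
    IsLocalization.Away.mul_invSelf (Ideal.Quotient.mk I u), fun t ht => ?_, fun p hp => ?_⟩
  · rw [RingHom.comp_apply, Ideal.Quotient.eq_zero_iff_mem.2 ht, map_zero]
  · obtain ⟨⟨_, n, rfl⟩, hn⟩ :=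
      (IsLocalization.map_eq_zero_iff (Submonoid.powers (Ideal.Quotient.mk I u)) _ _).1 hp
    refine ⟨n, Ideal.Quotient.eq_zero_iff_mem.1 ?_⟩
    simpa using hn

section Rees

variable {A : Type*} [CommRing A] {n : ℕ} (f : A) (g : Fin n → A)

lemma reesPhi_X_zero : reesPhi f g (X 0) = Polynomial.C f * Polynomial.X := by
  simp [reesPhi]

lemma reesPhi_X_succ (j : Fin n) :
    reesPhi f g (X j.succ) = Polynomial.C (g j) * Polynomial.X := by
  simp [reesPhi]

lemma reesPhi_C (c : A) : reesPhi f g (C c) = Polynomial.C c := by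
  simp [reesPhi]

lemma C_mul_X_succ_sub_mem_kerOne (j : Fin n) :
    C f * X j.succ - C (g j) * X 0 ∈ kerOne f g := by
  refine Ideal.subset_span ⟨?_, ?_⟩
  · rw [RingHom.mem_ker]
    simp only [map_sub, map_mul, reesPhi_C, reesPhi_X_succ, reesPhi_X_zero]
    ring
  · exact (isHomogeneous_C_mul_X _ _).sub (isHomogeneous_C_mul_X _ _)

/-- Away from `f`, the Rees algebra is of linear type. -/
lemma exists_C_pow_mul_mem_kerOne {p : MvPolynomial (Fin (n + 1)) A}
    (hp : p ∈ RingHom.ker (reesPhi f g)) : ∃ N : ℕ, C f ^ N * p ∈ kerOne f g := by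
  obtain ⟨Λ, _, q, i, hi, hI, hq⟩ := exists_ringHom_away_quotient (kerOne f g) (C f)
  have key : q = (Polynomial.eval₂RingHom (q.comp C) (q (X 0) * i)).comp
      (reesPhi f g : _ →+* Polynomial A) := by
    refine ringHom_ext (fun r => ?_) (fun j => ?_)
    · simp
    · refine Fin.cases ?_ (fun j => ?_) j
      · simp only [RingHom.comp_apply, RingHom.coe_coe, reesPhi_X_zero, map_mul,
          Polynomial.coe_eval₂RingHom, Polynomial.eval₂_C, Polynomial.eval₂_X]
        linear_combination -q (X 0) * hi
      · have h0 : q (C f * X j.succ - C (g j) * X 0) = 0 :=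
          hI _ (C_mul_X_succ_sub_mem_kerOne f g j)
        rw [map_sub, map_mul, map_mul] at h0
        simp only [RingHom.comp_apply, RingHom.coe_coe, reesPhi_X_succ, map_mul,
          Polynomial.coe_eval₂RingHom, Polynomial.eval₂_C, Polynomial.eval₂_X]
        linear_combination -q (X j.succ) * hi + i * h0
  refine hq p ?_
  rw [key, RingHom.comp_apply, RingHom.coe_coe, RingHom.mem_ker.1 hp, map_zero]

end Rees

section DSeven

local notation "P₃" => MvPolynomial (Fin 3) ℂ

local notation "P₄" => MvPolynomial (Fin 4) (MvPolynomial (Fin 3) ℂ)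

/-- The symbol of the logarithmic derivation `x₁∂₁ + x₂∂₂`. -/
noncomputable def symbolEuler : P₄ := C (X 0) * X 1 + C (X 1) * X 2 - 8 * X 0

/-- The symbol of the logarithmic derivation `(x₁x₃ + x₂)∂₃`. -/
noncomputable def symbolVert : P₄ := C (X 0 * X 2 + X 1) * X 3 - C (X 0) * X 0

/-- The symbol of a logarithmic derivation completing the previous two to a basis. -/
noncomputable def symbolDiag : P₄ :=
  C (X 1 ^ 6) * X 1 + C (X 0 ^ 6) * X 2 + C (X 2 ^ 2 * X 1 ^ 5 - X 0 ^ 5) * X 3 -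
    C (X 2 * X 1 ^ 5) * X 0

/-- The ideal generated by the three symbols. -/
noncomputable abbrev symbolIdeal : Ideal P₄ :=
  Ideal.span {symbolEuler, symbolVert, symbolDiag}

lemma pderiv_zero_fD7 : pderiv 0 fD7 =
    X 2 * (X 0 ^ 7 - X 1 ^ 7) + (X 0 * X 2 + X 1) * (7 * X 0 ^ 6) := by
  simp [fD7, Derivation.leibniz, Derivation.leibniz_pow, pderiv_X]
  ring

lemma pderiv_one_fD7 : pderiv 1 fD7 =
    (X 0 ^ 7 - X 1 ^ 7) - (X 0 * X 2 + X 1) * (7 * X 1 ^ 6) := by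
  simp [fD7, Derivation.leibniz, Derivation.leibniz_pow, pderiv_X]
  ring

lemma pderiv_two_fD7 : pderiv 2 fD7 = X 0 * (X 0 ^ 7 - X 1 ^ 7) := by
  simp [fD7, Derivation.leibniz, Derivation.leibniz_pow, pderiv_X]
  ring

/-- The polynomial `x₁x₃ + x₂` generates the kernel of the substitution `x₂ ↦ -x₁x₃`. -/
lemma X_mul_X_add_X_dvd_of_mul {u v : P₃} (h : (X 0 * X 2 + X 1 : P₃) ∣ u * v)
    (hu : aeval ![X 0, -(X 0 * X 2), X 2] u ≠ (0 : P₃)) : (X 0 * X 2 + X 1 : P₃) ∣ v := by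
  set σ : P₃ →ₐ[ℂ] P₃ := aeval ![X 0, -(X 0 * X 2), X 2] with hσ
  have hv : σ v = 0 := by
    have hL : σ (X 0 * X 2 + X 1) = 0 := by simp [hσ]
    have := map_dvd σ h
    rw [hL, zero_dvd_iff, map_mul] at this
    exact (mul_eq_zero.1 this).resolve_left hu
  set J : Ideal P₃ := Ideal.span {X 0 * X 2 + X 1}
  have key : (Ideal.Quotient.mkₐ ℂ J) = (Ideal.Quotient.mkₐ ℂ J).comp σ := by
    refine algHom_ext (fun i => ?_)
    simp only [AlgHom.comp_apply, Ideal.Quotient.mkₐ_eq_mk]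
    rw [Ideal.Quotient.eq, Ideal.mem_span_singleton]
    fin_cases i <;> simp [hσ, add_comm]
  have := DFunLike.congr_fun key v
  rw [AlgHom.comp_apply, hv, map_zero, Ideal.Quotient.mkₐ_eq_mk,
    Ideal.Quotient.eq_zero_iff_mem, Ideal.mem_span_singleton] at this
  exact this

lemma not_X_dvd_of_eval_ne_zero {σ : Type*} {i : σ} {p : MvPolynomial σ ℂ} (v : σ → ℂ)
    (hv : v i = 0) (hp : eval v p ≠ 0) : ¬ X i ∣ p := fun h => hp <| by
  have := map_dvd (eval v) h
  simpa [hv] using this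

/-- Saito's criterion for `D₇`, in coordinates. -/
lemma exists_of_syzygy {a₀ a₁ a₂ a₃ : P₃}
    (h : a₀ * fD7 + a₁ * pderiv 0 fD7 + a₂ * pderiv 1 fD7 + a₃ * pderiv 2 fD7 = 0) :
    ∃ c k d : P₃, a₁ = c * X 0 + d * X 1 ^ 6 ∧ a₂ = c * X 1 + d * X 0 ^ 6 ∧
      a₃ = d * (X 2 ^ 2 * X 1 ^ 5 - X 0 ^ 5) + k * (X 0 * X 2 + X 1) ∧
      a₀ = -8 * c - k * X 0 - d * (X 2 * X 1 ^ 5) := by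
  rw [pderiv_zero_fD7, pderiv_one_fD7, pderiv_two_fD7, fD7] at h
  have hL : (X 0 * X 2 + X 1 : P₃) ≠ 0 := fun h0 => by
    simpa using congrArg (eval ![0, 1, 0]) h0
  have h7 : (C (7⁻¹) : P₃) * 7 = 1 := by
    rw [show (7 : P₃) = C 7 from (map_ofNat C 7).symm, ← C_mul]; norm_num
  have hm : (X 0 * X 2 + X 1 : P₃) ∣ (X 0 ^ 7 - X 1 ^ 7) * (a₁ * X 2 + a₂ + a₃ * X 0) :=
    ⟨-(7 * (a₁ * X 0 ^ 6 - a₂ * X 1 ^ 6) + a₀ * (X 0 ^ 7 - X 1 ^ 7)), by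
      linear_combination h⟩
  obtain ⟨e, he⟩ := X_mul_X_add_X_dvd_of_mul hm fun h0 => by
    simpa using congrArg (eval ![1, 0, 0]) h0
  have h1 : 7 * (a₁ * X 0 ^ 6 - a₂ * X 1 ^ 6) + a₀ * (X 0 ^ 7 - X 1 ^ 7) +
      (X 0 ^ 7 - X 1 ^ 7) * e = 0 := by
    refine mul_left_cancel₀ hL ?_
    linear_combination h - (X 0 ^ 7 - X 1 ^ 7) * he
  set c : P₃ := -(C 7⁻¹ * (a₀ + e)) with hc
  have h2 : X 0 ^ 6 * (a₁ - c * X 0) = X 1 ^ 6 * (a₂ - c * X 1) := by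
    linear_combination C 7⁻¹ * h1 - (a₁ * X 0 ^ 6 - a₂ * X 1 ^ 6) * h7 -
      (X 0 ^ 7 - X 1 ^ 7) * hc
  have hx : Prime (X 0 : P₃) := X_prime
  have hxy : ¬ (X 0 : P₃) ∣ X 1 ^ 6 := not_X_dvd_of_eval_ne_zero ![0, 1, 0] (by simp) (by simp)
  obtain ⟨d, hd⟩ : (X 0 : P₃) ^ 6 ∣ a₂ - c * X 1 :=
    hx.pow_dvd_of_dvd_mul_left 6 hxy (Dvd.intro _ h2)
  have h3 : a₁ - c * X 0 = X 1 ^ 6 * d := by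
    refine mul_left_cancel₀ (pow_ne_zero 6 hx.ne_zero) ?_
    linear_combination h2 + X 1 ^ 6 * hd
  obtain ⟨k, hk⟩ : (X 0 * X 2 + X 1 : P₃) ∣ a₃ - d * (X 2 ^ 2 * X 1 ^ 5 - X 0 ^ 5) := by
    refine X_mul_X_add_X_dvd_of_mul (u := X 0) ⟨e - c - d * (X 2 * X 1 ^ 5), ?_⟩ (by simp)
    linear_combination he - X 2 * h3 - hd
  refine ⟨c, k, d, by linear_combination h3, by linear_combination hd,
    by linear_combination hk, ?_⟩
  have h4 : c + d * (X 2 * X 1 ^ 5) + X 0 * k - e = 0 := by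
    refine mul_left_cancel₀ hL ?_
    linear_combination he - X 2 * h3 - hd - X 0 * hk
  linear_combination 7 * hc - (a₀ + e) * h7 + h4

/-- The three symbols generate `ker^{(1)} φ` for `D₇`. -/
lemma kerOne_fD7 : kerOne fD7 (fun j => pderiv j fD7) = symbolIdeal := by
  have hker (a₀ a₁ a₂ a₃ : P₃) : C a₀ * X 0 + C a₁ * X 1 + C a₂ * X 2 + C a₃ * X 3 ∈
      RingHom.ker (reesPhi fD7 fun j => pderiv j fD7) ↔
      a₀ * fD7 + a₁ * pderiv 0 fD7 + a₂ * pderiv 1 fD7 + a₃ * pderiv 2 fD7 = 0 := by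
    have e1 := reesPhi_X_succ fD7 (fun j => pderiv j fD7) 0
    have e2 := reesPhi_X_succ fD7 (fun j => pderiv j fD7) 1
    have e3 := reesPhi_X_succ fD7 (fun j => pderiv j fD7) 2
    simp only [Fin.succ_zero_eq_one, Fin.succ_one_eq_two, Fin.reduceSucc] at e1 e2 e3
    rw [RingHom.mem_ker, ← Polynomial.monomial_eq_zero_iff (R := P₃) _ 1,
      ← Polynomial.C_mul_X_eq_monomial]
    simp only [map_add, map_mul, reesPhi_C, reesPhi_X_zero, e1, e2, e3, add_mul, mul_assoc]
  have hhom (a₀ a₁ a₂ a₃ : P₃) : (C a₀ * X 0 + C a₁ * X 1 + C a₂ * X 2 + C a₃ * X 3 :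
      P₄).IsHomogeneous 1 :=
    (((isHomogeneous_C_mul_X _ _).add (isHomogeneous_C_mul_X _ _)).add
      (isHomogeneous_C_mul_X _ _)).add (isHomogeneous_C_mul_X _ _)
  have hmem (a₀ a₁ a₂ a₃ : P₃) (h : a₀ * fD7 + a₁ * pderiv 0 fD7 + a₂ * pderiv 1 fD7 +
      a₃ * pderiv 2 fD7 = 0) : C a₀ * X 0 + C a₁ * X 1 + C a₂ * X 2 + C a₃ * X 3 ∈
      kerOne fD7 (fun j => pderiv j fD7) :=
    Ideal.subset_span ⟨(hker _ _ _ _).2 h, hhom _ _ _ _⟩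
  apply le_antisymm
  · refine Ideal.span_le.2 ?_
    rintro p ⟨hp, hp1⟩
    obtain ⟨a, rfl⟩ : ∃ a : Fin 4 → P₃, ∑ i, a i • X i = p := by
      rw [← mem_homogeneousSubmodule, homogeneousSubmodule_one_eq_span_X] at hp1
      exact Submodule.mem_span_range_iff_exists_fun _ |>.1 hp1
    simp only [Fin.sum_univ_four, smul_eq_C_mul] at hp ⊢
    obtain ⟨c, k, d, h1, h2, h3, h0⟩ := exists_of_syzygy ((hker _ _ _ _).1 hp)
    refine Ideal.mem_span_insert.2 ⟨C c, C k * symbolVert + C d * symbolDiag,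
      Ideal.mem_span_pair.2 ⟨_, _, rfl⟩, ?_⟩
    rw [h0, h1, h2, h3]
    simp only [symbolEuler, symbolVert, symbolDiag, map_add, map_sub, map_mul, map_pow,
      map_neg, map_ofNat]
    ring
  · refine Ideal.span_le.2 ?_
    rintro _ (rfl | rfl | rfl)
    · have := hmem (-8) (X 0) (X 1) 0 (by
        rw [pderiv_zero_fD7, pderiv_one_fD7, pderiv_two_fD7, fD7]; ring)
      rw [SetLike.mem_coe]
      convert this using 1
      simp only [symbolEuler, map_neg, map_ofNat, map_zero]
      ring
    · have := hmem (-X 0) 0 0 (X 0 * X 2 + X 1) (by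
        rw [pderiv_zero_fD7, pderiv_one_fD7, pderiv_two_fD7, fD7]; ring)
      rw [SetLike.mem_coe]
      convert this using 1
      simp only [symbolVert, map_neg, map_zero]
      ring
    · have := hmem (-(X 2 * X 1 ^ 5)) (X 1 ^ 6) (X 0 ^ 6) (X 2 ^ 2 * X 1 ^ 5 - X 0 ^ 5) (by
        rw [pderiv_zero_fD7, pderiv_one_fD7, pderiv_two_fD7, fD7]; ring)
      rw [SetLike.mem_coe]
      convert this using 1
      simp only [symbolDiag, map_neg]
      ring

section Chart

local notation "B₅" => MvPolynomial (Fin 5) ℂ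

/-- The chart `(x, κ, ξ₂, θ, a)` on the zero locus of the first two symbols, an isomorphism
where `a = ξ₃` is invertible. -/
noncomputable def chart : P₄ →+* B₅ :=
  eval₂Hom (eval₂Hom C ![X 0, X 0 * X 1, X 0 * X 3 - X 1])
    ![X 0 * X 4 * X 3, 8 * (X 4 * X 3) - X 1 * X 2, X 2, X 4]

/-- The equation of the Rees algebra in the chart. -/
noncomputable def chartEq : B₅ :=
  7 * (X 0 * X 1 ^ 6 * X 4 * X 3) + (1 - X 1 ^ 7) * (X 0 * X 2 - X 4)

lemma chart_symbolEuler : chart symbolEuler = 0 := by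
  simp [chart, symbolEuler]
  ring

lemma chart_symbolVert : chart symbolVert = 0 := by
  simp [chart, symbolVert]
  ring

lemma chart_symbolDiag : chart symbolDiag = X 0 ^ 5 * chartEq := by
  simp [chart, symbolDiag, chartEq]
  ring

lemma chart_C_fD7 : chart (C fD7) = X 0 ^ 9 * X 3 * (1 - X 1 ^ 7) := by
  simp [chart, fD7]
  ring

lemma Prime.dvd_of_dvd_mul_of_not_dvd {M : Type*} [CommMonoidWithZero M] [IsCancelMulZero M]
    {p c Q : M} (hp : Prime p) (hc : ¬ p ∣ c) (h : c ∣ p * Q) : c ∣ Q := by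
  obtain ⟨r, hr⟩ := h
  obtain ⟨r, rfl⟩ := (hp.dvd_or_dvd (Dvd.intro _ hr)).resolve_left hc
  exact ⟨r, mul_left_cancel₀ hp.ne_zero (by rw [hr, mul_left_comm])⟩

lemma one_sub_X_pow_dvd_of_dvd_chartEq_mul {Q : B₅} (h : 1 - X 1 ^ 7 ∣ chartEq * Q) :
    1 - X 1 ^ 7 ∣ Q := by
  have hX (i : Fin 5) : ¬ (X i : B₅) ∣ 1 - X 1 ^ 7 :=
    not_X_dvd_of_eval_ne_zero 0 (by simp) (by simp)
  have strip (i : Fin 5) {Q : B₅} (h : 1 - X 1 ^ 7 ∣ X i * Q) : 1 - X 1 ^ 7 ∣ Q :=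
    X_prime.dvd_of_dvd_mul_of_not_dvd (hX i) h
  have h7 : (C (7⁻¹) : B₅) * 7 = 1 := by
    rw [show (7 : B₅) = C 7 from (map_ofNat C 7).symm, ← C_mul]; norm_num
  obtain ⟨r, hr⟩ := h
  have : 1 - X 1 ^ 7 ∣ (X 0 * (X 1 * (X 1 * (X 1 * (X 1 * (X 1 * (X 1 * (X 4 * (X 3 * Q)))))))) :
      B₅) := by
    refine ⟨C 7⁻¹ * (r - (X 0 * X 2 - X 4) * Q), ?_⟩
    rw [chartEq] at hr
    linear_combination C 7⁻¹ * hr - X 0 * X 1 ^ 6 * X 4 * X 3 * Q * h7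
  exact strip 3 <| strip 4 <| strip 1 <| strip 1 <| strip 1 <| strip 1 <| strip 1 <| strip 1 <|
    strip 0 this

lemma chart_fD7_pow_dvd_of_dvd_chartEq_mul {N : ℕ} {Q : B₅}
    (h : chart (C fD7) ^ N ∣ chartEq * Q) : chart (C fD7) ^ N ∣ Q := by
  have good_X (i : Fin 5) (hi : i ≠ 4) (Q : B₅) (h : X i ∣ chartEq * Q) : X i ∣ Q := by
    refine (X_prime.dvd_or_dvd h).resolve_left
      (not_X_dvd_of_eval_ne_zero (Pi.single 4 1) (by simp [hi]) ?_)
    simp [chartEq]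
  have good_mul {c d : B₅} (hc : ∀ Q, c ∣ chartEq * Q → c ∣ Q)
      (hd : ∀ Q, d ∣ chartEq * Q → d ∣ Q) (Q : B₅) (h : c * d ∣ chartEq * Q) : c * d ∣ Q := by
    by_cases hc0 : c = 0
    · subst hc0
      simpa using hc Q (by simpa using h)
    · obtain ⟨Q, rfl⟩ := hc Q ((Dvd.intro _ rfl).trans h)
      rw [mul_left_comm] at h
      exact mul_dvd_mul_left c (hd Q ((mul_dvd_mul_iff_left hc0).1 h))
  have good_pow {c : B₅} (hc : ∀ Q, c ∣ chartEq * Q → c ∣ Q) (n : ℕ) :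
      ∀ Q, c ^ n ∣ chartEq * Q → c ^ n ∣ Q := by
    induction n with
    | zero => simp
    | succ n ih =>
      rw [pow_succ]
      exact good_mul ih hc
  refine good_pow ?_ N Q h
  rw [chart_C_fD7]
  exact good_mul (good_mul (good_pow (good_X 0 (by decide)) 9) (good_X 3 (by decide)))
    fun Q => one_sub_X_pow_dvd_of_dvd_chartEq_mul

lemma chartEq_dvd_chart {p : P₄}
    (hp : p ∈ RingHom.ker (reesPhi fD7 fun j => pderiv j fD7)) : chartEq ∣ chart p := by
  obtain ⟨N, hN⟩ := exists_C_pow_mul_mem_kerOne _ _ hp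
  rw [kerOne_fD7, Ideal.mem_span_insert] at hN
  obtain ⟨α, _, hz, hN⟩ := hN
  obtain ⟨β, γ, rfl⟩ := Ideal.mem_span_pair.1 hz
  have h := congrArg chart hN
  simp only [map_mul, map_add, map_pow, chart_symbolEuler, chart_symbolVert,
    chart_symbolDiag, mul_zero, zero_add] at h
  obtain ⟨Q, hQ⟩ : chart (C fD7) ^ N ∣ chart γ * X 0 ^ 5 :=
    chart_fD7_pow_dvd_of_dvd_chartEq_mul ⟨chart p, by linear_combination -h⟩
  have hne : chart (C fD7) ^ N ≠ 0 := by
    refine pow_ne_zero _ fun h0 => ?_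
    rw [chart_C_fD7] at h0
    simpa using congrArg (eval ![1, 0, 0, 1, 0]) h0
  exact ⟨Q, mul_left_cancel₀ hne (by linear_combination h + chartEq * hQ)⟩

/-- The inverse of the chart where `ξ₃` is invertible. -/
lemma exists_X_three_pow_mul_mem {p : P₄} (hp : X 0 ^ 5 * chartEq ∣ chart p) :
    ∃ m : ℕ, X 3 ^ m * p ∈ symbolIdeal := by
  obtain ⟨Λ, _, q, i, hi, hI, hq⟩ := exists_ringHom_away_quotient symbolIdeal (X 3)
  have h1 : q symbolEuler = 0 := hI _ (Ideal.subset_span (by simp))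
  have h2 : q symbolVert = 0 := hI _ (Ideal.subset_span (by simp))
  have h3 : q symbolDiag = 0 := hI _ (Ideal.subset_span (by simp))
  set x := q (C (X 0)) with hx
  set y := q (C (X 1)) with hy
  set z := q (C (X 2)) with hz
  set s := q (X 0)
  set ξ := q (X 1)
  set η := q (X 2)
  set a := q (X 3)
  set e := q (C (C 8⁻¹)) with he
  have he8 : e * 8 = 1 := by
    rw [he, ← map_ofNat q 8, ← map_mul, show (8 : P₄) = C (C 8) by rw [map_ofNat, map_ofNat],
      ← C_mul, ← C_mul]
    norm_num
  simp only [symbolEuler, symbolVert, map_add, map_sub, map_mul, map_ofNat] at h1 h2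
  set κ := (s - z * a) * i with hκ
  set θ := (ξ + κ * η) * e * i with hθ
  have hy' : x * κ = y := by linear_combination -i * h2 + y * hi + x * hκ
  have hs : x * a * θ = s := by
    linear_combination x * a * hθ + x * (ξ + κ * η) * e * hi + e * h1 + e * η * hy' + s * he8
  have hz' : x * θ - κ = z := by
    linear_combination i * hs - hκ + (z - x * θ) * hi
  have hξ : 8 * (a * θ) - κ * η = ξ := by
    linear_combination 8 * a * hθ + 8 * e * (ξ + κ * η) * hi + (ξ + κ * η) * he8
  set χ : B₅ →+* Λ := eval₂Hom (q.comp (C.comp C)) ![x, κ, η, θ, a] with hχ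
  have key : q = χ.comp chart := by
    refine ringHom_ext' (ringHom_ext' ?_ ?_) ?_
    · ext r
      simp [hχ, chart]
    · intro j
      fin_cases j <;> simp [hχ, chart, hy', hz', ← hx, ← hy, ← hz]
    · intro j
      fin_cases j
      · simpa [hχ, chart] using hs.symm
      · simpa [hχ, chart] using hξ.symm
      · simp [hχ, chart, η]
      · simp [hχ, chart, a]
  refine hq p ?_
  obtain ⟨Q, hQ⟩ := hp
  rw [key, RingHom.comp_apply, hQ, ← chart_symbolDiag, map_mul, ← RingHom.comp_apply, ← key, h3,
    zero_mul]

end Chart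

section Regular

local notation "D₄" => MvPolynomial (Fin 4) ℂ

/-- Setting `ξ₃ = 0` and eliminating `s` by means of `symbolEuler`; the variables are
`x₁, x₂, x₃, ξ₂` and the polynomial variable `ξ₁`. -/
noncomputable def restrict : P₄ →+* Polynomial D₄ :=
  eval₂Hom (eval₂Hom (Polynomial.C.comp C)
      ![Polynomial.C (X 0), Polynomial.C (X 1), Polynomial.C (X 2)])
    ![Polynomial.C (C 8⁻¹) *
        (Polynomial.C (X 0) * Polynomial.X + Polynomial.C (X 1 * X 3)),
      Polynomial.X, Polynomial.C (X 3), 0]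

/-- A section of `restrict`. -/
noncomputable def restrictSection : Polynomial D₄ →+* P₄ :=
  Polynomial.eval₂RingHom (eval₂Hom (C.comp C) ![C (X 0), C (X 1), C (X 2), X 2]) (X 1)

lemma exists_eq_restrictSection_add (q : P₄) :
    ∃ u v, q = restrictSection (restrict q) + X 3 * u + symbolEuler * v := by
  set J : Ideal P₄ := Ideal.span {X 3, symbolEuler} with hJ
  have h3 : Ideal.Quotient.mk J (X 3) = 0 :=
    Ideal.Quotient.eq_zero_iff_mem.2 (Ideal.subset_span (by simp))
  have h8 : (C (C 8⁻¹) : P₄) * 8 = 1 := by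
    rw [show (8 : P₄) = C (C 8) by rw [map_ofNat, map_ofNat], ← C_mul, ← C_mul]
    norm_num
  have key : Ideal.Quotient.mk J =
      (Ideal.Quotient.mk J).comp (restrictSection.comp restrict) := by
    refine ringHom_ext' (ringHom_ext' ?_ ?_) ?_
    · ext r
      simp [restrict, restrictSection]
    · intro j
      fin_cases j <;> simp [restrict, restrictSection]
    · intro j
      fin_cases j
      · refine Ideal.Quotient.eq.2 (Ideal.mem_span_pair.2 ⟨0, -C (C 8⁻¹), ?_⟩)
        simp [restrict, restrictSection, symbolEuler]
        linear_combination X 0 * h8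
      · simp [restrict, restrictSection]
      · simp [restrict, restrictSection]
      · simpa [restrict, restrictSection] using h3
  have hq : q - restrictSection (restrict q) ∈ J :=
    Ideal.Quotient.eq.1 (DFunLike.congr_fun key q)
  obtain ⟨u, v, h⟩ := Ideal.mem_span_pair.1 hq
  exact ⟨u, v, by linear_combination -h⟩

lemma not_dvd_of_map_eq_zero {R S : Type*} [CommRing R] [CommRing S] (f : R →+* S) {p q : R}
    (hp : f p = 0) (hq : f q ≠ 0) : ¬ p ∣ q := fun h => hq <| by
  simpa [hp] using map_dvd f h

lemma mem_symbolIdeal_of_X_three_mul_mem {c : P₄} (hc : X 3 * c ∈ symbolIdeal) :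
    c ∈ symbolIdeal := by
  rw [symbolIdeal, Ideal.mem_span_insert] at hc
  obtain ⟨α, _, hz, hc⟩ := hc
  obtain ⟨β, γ, rfl⟩ := Ideal.mem_span_pair.1 hz
  set x : Polynomial D₄ := Polynomial.C (X 0) with hx
  set k : Polynomial D₄ := Polynomial.C (C 8⁻¹) with hk
  set e : Polynomial D₄ := x * Polynomial.X + Polynomial.C (X 1 * X 3) with he
  set F := restrict symbolDiag with hF
  have hk8 : k * 8 = 1 := by
    rw [hk, show (8 : Polynomial D₄) = Polynomial.C (C 8) by rw [map_ofNat, map_ofNat],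
      ← Polynomial.C_mul, ← C_mul]
    norm_num
  have hFe : F = Polynomial.C (X 1 ^ 6) * Polynomial.X + Polynomial.C (X 0 ^ 6 * X 3) -
      Polynomial.C (X 2 * X 1 ^ 5) * (k * e) := by
    simp [hF, restrict, symbolDiag, he, hx, hk]
  have hE : restrict symbolEuler = 0 := by
    have h8 : restrict 8 = 8 := map_ofNat restrict 8
    rw [symbolEuler, map_sub, map_mul restrict 8, h8,
      show restrict (X 0) = k * e by simp [restrict, he, hx, hk]]
    simp [restrict]
    linear_combination -e * hk8 + he + Polynomial.X * hx -
      Polynomial.C_mul (a := (X 1 : D₄)) (b := X 3)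
  have hV : restrict symbolVert = -(x * (k * e)) := by
    simp [restrict, symbolVert, he, hx, hk]
  have hxp : Prime x := Polynomial.prime_C_iff.2 X_prime
  have hxF : ¬ x ∣ F := by
    refine not_dvd_of_map_eq_zero (Polynomial.eval₂RingHom (eval ![0, 1, 0, 0]) 1) ?_ ?_
    · simp [hx]
    · rw [hFe]
      simp
  have hep : Prime e := by
    refine (Polynomial.irreducible_C_mul_X_add_C (X_ne_zero _) ?_).prime
    refine (X_prime.irreducible.isRelPrime_iff_not_dvd).2 ?_
    exact not_X_dvd_of_eval_ne_zero ![0, 1, 0, 1] (by simp) (by simp)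
  have heF : ¬ e ∣ F := by
    have he0 : Polynomial.eval₂ (eval ![1, -1, 0, 1]) 1 e = 0 := by simp [he, hx]
    refine not_dvd_of_map_eq_zero (Polynomial.eval₂RingHom (eval ![1, -1, 0, 1]) 1) ?_ ?_
    · simp [he, hx]
    · rw [hFe]
      simp only [map_sub, map_add, map_mul, map_pow, Polynomial.coe_eval₂RingHom,
        Polynomial.eval₂_C, Polynomial.eval₂_X, he0]
      simp
      norm_num
  have h0 : restrict γ * F = x * (restrict β * (k * e)) := by
    have h := congrArg restrict hc
    simp only [map_mul, map_add, hE, hV, ← hF] at h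
    rw [show restrict (X 3) = 0 by simp [restrict]] at h
    linear_combination -h
  obtain ⟨γ₁, hγ₁⟩ := (hxp.dvd_or_dvd (Dvd.intro _ h0.symm)).resolve_right hxF
  have h1 : γ₁ * F = restrict β * (k * e) :=
    mul_left_cancel₀ hxp.ne_zero (by linear_combination h0 - F * hγ₁)
  obtain ⟨γ₂, rfl⟩ := (hep.dvd_or_dvd (a := γ₁) (b := F)
    ⟨restrict β * k, by linear_combination h1⟩).resolve_right heF
  have h2 : restrict β = 8 * γ₂ * F :=
    mul_left_cancel₀ hep.ne_zero
      (by linear_combination -8 * h1 - e * restrict β * hk8)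
  obtain ⟨u₁, v₁, hγ⟩ := exists_eq_restrictSection_add γ
  obtain ⟨u₂, v₂, hβ⟩ := exists_eq_restrictSection_add β
  obtain ⟨u₃, v₃, hD⟩ := exists_eq_restrictSection_add symbolDiag
  have hsx : restrictSection x = C (X 0) := by simp [restrictSection, hx]
  have hse : restrictSection e = symbolEuler + 8 * X 0 := by
    simp [restrictSection, he, hx, symbolEuler]
  rw [hγ₁, map_mul, map_mul, hsx, hse] at hγ
  rw [h2, map_mul, map_mul, map_ofNat] at hβ
  rw [← hF] at hD
  set g := restrictSection γ₂
  have hV' : symbolVert = C (X 0 * X 2 + X 1) * X 3 - C (X 0) * X 0 := rfl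
  have hfin : X 3 * (c - ((u₂ - 8 * g * u₃) * symbolVert +
      (8 * g * C (X 0 * X 2 + X 1) + u₁) * symbolDiag)) =
      symbolEuler * (α - 8 * g * v₃ * symbolVert + v₂ * symbolVert +
        g * C (X 0) * symbolDiag + v₁ * symbolDiag) := by
    linear_combination hc + symbolVert * hβ + symbolDiag * hγ - 8 * g * symbolVert * hD +
      8 * g * symbolDiag * hV'
  have h3E : ¬ (X 3 : P₄) ∣ symbolEuler := by
    refine not_dvd_of_map_eq_zero (eval₂Hom (eval (0 : Fin 3 → ℂ)) ![1, 0, 0, 0]) ?_ ?_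
    · simp
    · simp [symbolEuler]
  obtain ⟨m, hm⟩ := (X_prime.dvd_or_dvd (Dvd.intro _ hfin)).resolve_left h3E
  have h3 : c - ((u₂ - 8 * g * u₃) * symbolVert +
      (8 * g * C (X 0 * X 2 + X 1) + u₁) * symbolDiag) = m * symbolEuler :=
    mul_left_cancel₀ (X_ne_zero (R := P₃) (3 : Fin 4))
      (by linear_combination hfin + symbolEuler * hm)
  rw [symbolIdeal, Ideal.mem_span_insert]
  exact ⟨m, (u₂ - 8 * g * u₃) * symbolVert +
    (8 * g * C (X 0 * X 2 + X 1) + u₁) * symbolDiag, Ideal.mem_span_pair.2 ⟨_, _, rfl⟩,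
    by linear_combination h3⟩

end Regular

lemma X_zero_pow_five_mul_mem {p : P₄}
    (hp : p ∈ RingHom.ker (reesPhi fD7 fun j => pderiv j fD7)) :
    X 0 ^ 5 * p ∈ symbolIdeal := by
  have hdvd : X 0 ^ 5 * chartEq ∣ chart (X 0 ^ 5 * p) := by
    rw [map_mul, map_pow]
    refine mul_dvd_mul (pow_dvd_pow_of_dvd ?_ 5) (chartEq_dvd_chart hp)
    simp [chart, mul_assoc]
  obtain ⟨m, hm⟩ := exists_X_three_pow_mul_mem hdvd
  induction m with
  | zero => simpa using hm
  | succ m ih =>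
    refine ih (mem_symbolIdeal_of_X_three_mul_mem ?_)
    rwa [← mul_assoc, ← pow_succ']

/-- A Rees relation that `s ^ 4` does not multiply into `ker^{(1)} φ`. -/
noncomputable def extraRelation : P₄ :=
  C (X 1) * (X 0 - C (X 2) * X 3) ^ 5 * X 1 + C (X 0) * X 3 ^ 5 * X 2 -
    C (X 2) * (X 0 - C (X 2) * X 3) ^ 6 - X 3 ^ 6

lemma extraRelation_identity {R : Type*} [CommRing R] (x y z t : R) :
    y * ((x * z + y) * (x ^ 7 - y ^ 7) * t - z * (x * (x ^ 7 - y ^ 7) * t)) ^ 5 *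
      ((z * (x ^ 7 - y ^ 7) + (x * z + y) * (7 * x ^ 6)) * t) +
      x * (x * (x ^ 7 - y ^ 7) * t) ^ 5 *
      ((x ^ 7 - y ^ 7 - (x * z + y) * (7 * y ^ 6)) * t) -
      z * ((x * z + y) * (x ^ 7 - y ^ 7) * t - z * (x * (x ^ 7 - y ^ 7) * t)) ^ 6 -
      (x * (x ^ 7 - y ^ 7) * t) ^ 6 = 0 := by
  rw [show (x * z + y) * (x ^ 7 - y ^ 7) * t - z * (x * (x ^ 7 - y ^ 7) * t) =
    y * ((x ^ 7 - y ^ 7) * t) by ring]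
  ring

lemma extraRelation_mem_ker :
    extraRelation ∈ RingHom.ker (reesPhi fD7 fun j => pderiv j fD7) := by
  have e1 := reesPhi_X_succ fD7 (fun j => pderiv j fD7) 0
  have e2 := reesPhi_X_succ fD7 (fun j => pderiv j fD7) 1
  have e3 := reesPhi_X_succ fD7 (fun j => pderiv j fD7) 2
  simp only [Fin.succ_zero_eq_one, Fin.succ_one_eq_two, Fin.reduceSucc] at e1 e2 e3
  rw [RingHom.mem_ker, extraRelation]
  simp only [map_add, map_sub, map_mul, map_pow, reesPhi_C, reesPhi_X_zero, e1, e2, e3]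
  rw [pderiv_zero_fD7, pderiv_one_fD7, pderiv_two_fD7, fD7]
  simp only [map_add, map_sub, map_mul, map_pow, map_ofNat]
  exact extraRelation_identity _ _ _ _

lemma exists_ringHom_polynomial : ∃ ψ : P₄ →+* Polynomial ℂ,
    (ψ (C (X 0)) = Polynomial.X ∧ ψ (C (X 1)) = Polynomial.X ^ 2 ∧ ψ (C (X 2)) = 0) ∧
    ψ (X 0) = Polynomial.X ∧ ψ (X 1) = 8 ∧ ψ (X 2) = 0 ∧ ψ (X 3) = 1 :=
  ⟨eval₂Hom (eval₂Hom Polynomial.C ![Polynomial.X, Polynomial.X ^ 2, 0])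
    ![Polynomial.X, 8, 0, 1], by simp only [coe_eval₂Hom, eval₂_C, eval₂_X]; exact ⟨rfl, rfl, rfl⟩,
    eval₂_X _ _ _, eval₂_X _ _ _, eval₂_X _ _ _, eval₂_X _ _ _⟩

lemma X_zero_pow_four_mul_extraRelation_not_mem :
    X 0 ^ 4 * extraRelation ∉ symbolIdeal := by
  intro h
  obtain ⟨ψ, ⟨hx, hy, hz⟩, h0, h1, h2, h3⟩ := exists_ringHom_polynomial
  obtain ⟨a, w, hw, h⟩ := Ideal.mem_span_insert.1 h
  obtain ⟨b, c, rfl⟩ := Ideal.mem_span_pair.1 hw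
  have hE : ψ symbolEuler = 0 := by
    rw [symbolEuler]
    simp only [map_add, map_sub, map_mul, map_ofNat, hx, hy, h0, h1, h2]
    ring
  have hV : ψ symbolVert = 0 := by
    rw [symbolVert]
    simp only [map_add, map_sub, map_mul, hx, hy, hz, h0, h3]
    ring
  have hD : ψ symbolDiag = Polynomial.X ^ 5 * (8 * Polynomial.X ^ 7 - 1) := by
    rw [symbolDiag]
    simp only [map_add, map_sub, map_mul, map_pow, hx, hy, hz, h0, h1, h2, h3]
    ring
  have hR : ψ extraRelation = 8 * Polynomial.X ^ 7 - 1 := by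
    rw [extraRelation]
    simp only [map_add, map_sub, map_mul, map_pow, hx, hy, hz, h0, h1, h2, h3]
    ring
  have h4 := congrArg ψ h
  simp only [map_add, map_mul, map_pow, hE, hV, hD, hR, h0] at h4
  have h5 : (8 * Polynomial.X ^ 7 - 1 : Polynomial ℂ) =
      Polynomial.X * (ψ c * (8 * Polynomial.X ^ 7 - 1)) :=
    mul_left_cancel₀ (pow_ne_zero 4 Polynomial.X_ne_zero) (by linear_combination h4)
  have h6 := congrArg (Polynomial.eval 0) h5
  simp at h6

end DSeven

/-- For the divisor `D_7`, with `g_j = ∂f_7/∂x_j`, one has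
`s^5·p ∈ ker^{(1)}φ` for every `p ∈ ker φ`, but there exists `p ∈ ker φ` with
`s^4·p ∉ ker^{(1)}φ`: property (GCL) holds with minimal exponent `N = 5`. -/
theorem D7_GCL_minimal_exponent :
    (∀ p ∈ RingHom.ker (reesPhi fD7 fun j => pderiv j fD7),
      (X 0 : MvPolynomial (Fin 4) (MvPolynomial (Fin 3) ℂ)) ^ 5 * p ∈
        kerOne fD7 fun j => pderiv j fD7) ∧
    (∃ p ∈ RingHom.ker (reesPhi fD7 fun j => pderiv j fD7),
      (X 0 : MvPolynomial (Fin 4) (MvPolynomial (Fin 3) ℂ)) ^ 4 * p ∉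
        kerOne fD7 fun j => pderiv j fD7) := by
  rw [kerOne_fD7]
  exact ⟨fun p hp => X_zero_pow_five_mul_mem hp,
    extraRelation, extraRelation_mem_ker, X_zero_pow_four_mul_extraRelation_not_mem⟩
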